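/- arXiv:2004.01537 — 2 statements merged into one kernel-verified Lean document; each statement's English description precedes it below -/
import Mathlib

section
/- For every r > 0 and every z ∈ ℝ² with z ≠ 0, the average (1/(π r²)) ∫_{B_r(0)} (log|z+h| − log|z|) dh equals 2π Σ(|z|/r). -/
open MeasureTheory Metric

noncomputable section

local notation "R2" => EuclideanSpace ℝ (Fin 2)

/-- `Σ(ρ) = (1/(4π))(|log ρ²| − 1 + ρ²)` for `ρ ≤ 1`, and `0` for `ρ > 1`. -/
def SigmaFun (ρ : ℝ) : ℝ :=
  if ρ ≤ 1 then (1 / (4 * Real.pi)) * (|Real.log (ρ ^ 2)| - 1 + ρ ^ 2) else 0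

lemma logAux_integrableOn (w : ℂ) (R : ℝ) :
    IntegrableOn (fun h : ℂ => Real.log ‖w + h‖ - Real.log ‖w‖) (ball 0 R) := by
  have h1 : Integrable (fun x : ℂ => (Set.Iio (‖w‖ + R)).indicator Real.log ‖x‖) := by
    rw [integrable_fun_norm_addHaar]
    have hc : IntegrableOn (fun y : ℝ => y * Real.log y) (Set.Icc 0 (‖w‖ + R)) :=
      Real.continuous_mul_log.continuousOn.integrableOn_compact isCompact_Icc
    have h2 : IntegrableOn (fun y : ℝ => y * Real.log y) (Set.Iio (‖w‖ + R) ∩ Set.Ioi 0) :=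
      hc.mono_set (fun x hx => ⟨le_of_lt hx.2, le_of_lt hx.1⟩)
    have h3 := (integrable_indicator_iff (μ := volume.restrict (Set.Ioi 0))
      (f := fun y : ℝ => y * Real.log y) (measurableSet_Iio (a := ‖w‖ + R))).2 (by
        rw [IntegrableOn, Measure.restrict_restrict measurableSet_Iio]; exact h2)
    refine h3.congr (Filter.Eventually.of_forall fun y => ?_)
    by_cases hy : y < ‖w‖ + R <;> simp [Set.indicator, hy, Complex.finrank_real_complex]
  have h2 := (h1.comp_add_left w).integrableOn (s := ball 0 R)
  have h3 : IntegrableOn (fun h : ℂ => Real.log ‖w + h‖) (ball 0 R) := by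
    refine h2.congr_fun (fun h hh => ?_) measurableSet_ball
    have : ‖w + h‖ < ‖w‖ + R := by
      have := norm_add_le w h
      have h' : ‖h‖ < R := by simpa using hh
      linarith
    simp [Set.indicator, this]
  exact h3.sub (integrableOn_const (by exact measure_ball_lt_top.ne))

lemma logAux_inner (w : ℂ) (s : ℝ) (hs : 0 < s) :
    ∫ θ in Set.Ioo (-Real.pi) Real.pi,
      (Real.log ‖w + s * (Real.cos θ + Real.sin θ * Complex.I)‖ - Real.log ‖w‖)
      = 2 * Real.pi * (Real.log s + Real.posLog (s⁻¹ * ‖w‖) - Real.log ‖w‖) := by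
  have hpi := Real.pi_pos
  have e : ∀ θ : ℝ, Real.log ‖w + s * (Real.cos θ + Real.sin θ * Complex.I)‖ - Real.log ‖w‖
      = ((fun x : ℂ => Real.log ‖x - (-w)‖) - (fun _ : ℂ => Real.log ‖w‖) : ℂ → ℝ) (circleMap 0 s θ) := by
    intro θ
    simp only [Pi.sub_apply, circleMap_zero, sub_neg_eq_add, Complex.exp_mul_I,
      Complex.ofReal_cos, Complex.ofReal_sin]
    rw [add_comm]
  simp_rw [e]
  rw [← integral_Ioc_eq_integral_Ioo, ← intervalIntegral.integral_of_le (by linarith)]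
  have hp : Function.Periodic (fun θ : ℝ =>
      ((fun x : ℂ => Real.log ‖x - (-w)‖) - (fun _ : ℂ => Real.log ‖w‖) : ℂ → ℝ) (circleMap 0 s θ))
      (2 * Real.pi) := (periodic_circleMap 0 s).comp _
  have h1 := hp.intervalIntegral_add_eq (-Real.pi) 0
  rw [show -Real.pi + 2 * Real.pi = Real.pi by ring, zero_add] at h1
  rw [h1]
  have h2 := Real.circleAverage_sub (circleIntegrable_log_norm_sub_const (a := -w) (c := 0) s)
    (circleIntegrable_const (Real.log ‖w‖) 0 s)
  rw [circleAverage_log_norm_sub_const_eq_log_radius_add_posLog hs.ne', Real.circleAverage_const,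
    Real.circleAverage_def, smul_eq_mul, inv_mul_eq_iff_eq_mul₀ (by positivity)] at h2
  rw [h2]
  simp

lemma logAux_polar (w : ℂ) (r : ℝ) :
    ∫ h in ball (0 : ℂ) r, (Real.log ‖w + h‖ - Real.log ‖w‖)
      = ∫ s in Set.Ioo 0 r, s * (2 * Real.pi *
          (Real.log s + Real.posLog (s⁻¹ * ‖w‖) - Real.log ‖w‖)) := by
  set f : ℂ → ℝ := (ball (0 : ℂ) r).indicator (fun h => Real.log ‖w + h‖ - Real.log ‖w‖) with hf
  have hfi : Integrable f := (integrable_indicator_iff measurableSet_ball).2 (logAux_integrableOn w r)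
  have hfm : Measurable f := by
    apply Measurable.indicator _ measurableSet_ball
    fun_prop
  have hsm : Measurable (fun p : ℝ × ℝ => Complex.polarCoord.symm p) := by
    simp only [Complex.polarCoord_symm_apply]
    fun_prop
  have hgi : IntegrableOn (fun p : ℝ × ℝ => p.1 • f (Complex.polarCoord.symm p))
      (Set.Ioi (0 : ℝ) ×ˢ Set.Ioo (-Real.pi) Real.pi) := by
    refine ⟨(measurable_fst.smul (hfm.comp hsm)).aestronglyMeasurable, ?_⟩
    have h1 := hfi.2
    rw [HasFiniteIntegral, ← Complex.lintegral_comp_polarCoord_symm] at h1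
    rw [HasFiniteIntegral]
    refine lt_of_eq_of_lt ?_ h1
    refine setLIntegral_congr_fun (measurableSet_Ioi.prod measurableSet_Ioo) (fun p hp => ?_)
    have : 0 < p.1 := hp.1
    simp only [smul_eq_mul]
    rw [enorm_mul, Real.enorm_of_nonneg this.le]
  rw [← integral_indicator measurableSet_ball, ← hf, ← Complex.integral_comp_polarCoord_symm]
  rw [show polarCoord.target = Set.Ioi (0 : ℝ) ×ˢ Set.Ioo (-Real.pi) Real.pi from rfl]
  rw [Measure.volume_eq_prod, setIntegral_prod _ hgi]
  have hset : Set.Ioo 0 r = Set.Ioi 0 ∩ Set.Iio r := by ext; simp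
  rw [hset, ← setIntegral_indicator measurableSet_Iio]
  refine setIntegral_congr_fun measurableSet_Ioi (fun s hs => ?_)
  have hs : 0 < s := hs
  simp only [smul_eq_mul]
  rw [integral_const_mul]
  by_cases hr : s < r
  · rw [Set.indicator_of_mem (by exact hr), ← logAux_inner w s hs]
    congr 1
    refine setIntegral_congr_fun measurableSet_Ioo (fun θ _ => ?_)
    have : Complex.polarCoord.symm (s, θ) ∈ ball (0 : ℂ) r := by
      rw [mem_ball_zero_iff, Complex.norm_polarCoord_symm, abs_of_pos hs]; exact hr
    simp only [hf]
    rw [Set.indicator_of_mem this, Complex.polarCoord_symm_apply]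
  · rw [Set.indicator_of_notMem (by exact hr)]
    have : ∀ θ, f (Complex.polarCoord.symm (s, θ)) = 0 := by
      intro θ
      apply Set.indicator_of_notMem
      rw [mem_ball_zero_iff, Complex.norm_polarCoord_symm, abs_of_pos hs]; exact hr
    simp only [this]
    simp

lemma logAux_radial (ρ r : ℝ) (hρ : 0 < ρ) (hr : 0 < r) :
    ∫ s in Set.Ioo 0 r, s * (2 * Real.pi * (Real.log s + Real.posLog (s⁻¹ * ρ) - Real.log ρ))
      = if ρ ≤ r then 2 * Real.pi *
        (r ^ 2 / 2 * (Real.log r - Real.log ρ) - r ^ 2 / 4 + ρ ^ 2 / 4) else 0 := by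
  set g : ℝ → ℝ := fun s =>
    s * (2 * Real.pi * (Real.log s + Real.posLog (s⁻¹ * ρ) - Real.log ρ)) with hg
  have hsmall : ∀ s, 0 < s → s ≤ ρ → g s = 0 := by
    intro s hs hsρ
    have h1 : 1 ≤ s⁻¹ * ρ := by rw [inv_mul_eq_div, one_le_div hs]; exact hsρ
    simp only [hg]
    rw [Real.posLog_eq_log (h1.trans (le_abs_self _)), Real.log_mul (by positivity) hρ.ne',
      Real.log_inv]
    ring
  have hbig : ∀ s, ρ ≤ s → g s = 2 * Real.pi * (s * (Real.log s - Real.log ρ)) := by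
    intro s hs
    have hs0 := hρ.trans_le hs
    have h1 : |s⁻¹ * ρ| ≤ 1 := by
      rw [abs_of_pos (by positivity), inv_mul_eq_div, div_le_one hs0]; exact hs
    simp only [hg]
    rw [(Real.posLog_eq_zero_iff _).2 h1]
    ring
  split_ifs with h
  · have hd : ∀ x ∈ Set.uIcc ρ r, HasDerivAt (fun s : ℝ =>
        2 * Real.pi * (s ^ 2 / 2 * (Real.log s - Real.log ρ) - s ^ 2 / 4))
        (2 * Real.pi * (x * (Real.log x - Real.log ρ))) x := by
      intro x hx
      rw [Set.uIcc_of_le h] at hx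
      have hx0 : x ≠ 0 := (hρ.trans_le hx.1).ne'
      have h1 := ((((hasDerivAt_pow 2 x).div_const 2).mul
        ((Real.hasDerivAt_log hx0).sub_const (Real.log ρ))).sub
        ((hasDerivAt_pow 2 x).div_const 4)).const_mul (2 * Real.pi)
      convert! h1 using 1
      field_simp
      push_cast
      ring
    have hci : ContinuousOn (fun x : ℝ => 2 * Real.pi * (x * (Real.log x - Real.log ρ)))
        (Set.uIcc ρ r) := by
      have : Continuous (fun x : ℝ => 2 * Real.pi * (x * Real.log x - x * Real.log ρ)) := by
        have := Real.continuous_mul_log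
        fun_prop
      refine this.continuousOn.congr fun x _ => ?_
      ring
    have hF := intervalIntegral.integral_eq_sub_of_hasDerivAt hd hci.intervalIntegrable
    rw [setIntegral_eq_of_subset_of_forall_sdiff_eq_zero (s := Set.Ioo ρ r) (t := Set.Ioo 0 r) measurableSet_Ioo
      (Set.Ioo_subset_Ioo_left hρ.le)
      (fun x hx => hsmall x hx.1.1 (by
        by_contra hc
        exact hx.2 ⟨not_le.1 hc, hx.1.2⟩))]
    rw [setIntegral_congr_fun measurableSet_Ioo (fun x hx => hbig x hx.1.le),
      ← integral_Ioc_eq_integral_Ioo, ← intervalIntegral.integral_of_le h, hF]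
    ring
  · rw [setIntegral_congr_fun measurableSet_Ioo
      (fun x hx => hsmall x hx.1 (hx.2.le.trans (not_le.1 h).le))]
    simp

theorem stmt10 (r : ℝ) (hr : 0 < r) (z : R2) (hz : z ≠ 0) :
    (1 / (Real.pi * r ^ 2)) *
        ∫ h in ball (0 : R2) r, (Real.log ‖z + h‖ - Real.log ‖z‖)
      = 2 * Real.pi * SigmaFun (‖z‖ / r) := by
  let e := Complex.orthonormalBasisOneI.repr.symm
  have hm : MeasurePreserving e volume volume := e.measurePreserving
  have hw : 0 < ‖z‖ := norm_pos_iff.2 hz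
  have key : ∫ h in ball (0 : R2) r, (Real.log ‖z + h‖ - Real.log ‖z‖)
      = ∫ h in ball (0 : ℂ) r, (Real.log ‖e z + h‖ - Real.log ‖e z‖) := by
    rw [← hm.setIntegral_preimage_emb e.toHomeomorph.measurableEmbedding]
    have : e ⁻¹' ball (0 : ℂ) r = ball (0 : R2) r := by
      ext x; simp
    rw [this]
    refine setIntegral_congr_fun measurableSet_ball (fun h _ => ?_)
    simp only [← map_add, LinearIsometryEquiv.norm_map]
  rw [key, logAux_polar, LinearIsometryEquiv.norm_map, logAux_radial _ _ hw hr, SigmaFun]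
  have hpi := Real.pi_pos
  simp only [div_le_one hr]
  split_ifs with h
  · have h1 : Real.log ((‖z‖ / r) ^ 2) ≤ 0 :=
      Real.log_nonpos (by positivity) (pow_le_one₀ (by positivity) ((div_le_one hr).2 h))
    rw [abs_of_nonpos h1, Real.log_pow, Real.log_div hw.ne' hr.ne']
    field_simp
    push_cast
    ring
  · simp
end
end

section
/- Fix 0 < α < 2, C_M > 0 and Ω̄ > 0, and let φ(x) = (1/π) (1 + |x|²)^{−2} be the Krasny blob function on ℝ². Then there exists a constant C > 0, depending only on α, C_M and Ω̄, with the following property. For every 0 < ε ≤ 1, every N ∈ ℕ, every ξ₁,…,ξ_N ∈ ℝ with Σ_{j=1}^N |ξ_j| ≤ Ω̄, and every X₁,…,X_N ∈ ℝ², define φ_ε(x) = ε^{−2} φ(x/ε), ω^ε(x) = Σ_{j=1}^N ξ_j φ_ε(x − X_j), G_ε(x) = −(1/(4π)) log(|x|² + ε²), ψ^ε(x) = Σ_{j=1}^N ξ_j G_ε(x − X_j), E^ε = ∫_{ℝ²} ψ^ε(x) ω^ε(x) dx, and 𝓔^ε = Σ_{i,j=1}^N ξ_i ξ_j G_ε(X_i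 − X_j). If M_r(ω^ε) ≤ C_M r^α for all r > 0, then |E^ε − 𝓔^ε| ≤ C ε^α. -/
open MeasureTheory Metric

noncomputable section

local notation "R2" => EuclideanSpace ℝ (Fin 2)

/-- The Krasny blob function `φ(x) = (1/π) (1 + |x|²)⁻²`. -/
def blob (x : R2) : ℝ := (1 / Real.pi) * ((1 + ‖x‖ ^ 2) ^ 2)⁻¹

/-- The regularized Green's function `G_ε(x) = -(1/(4π)) log(|x|² + ε²)`. -/
def Greg (ε : ℝ) (x : R2) : ℝ := -(1 / (4 * Real.pi)) * Real.log (‖x‖ ^ 2 + ε ^ 2)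

/-- Vorticity maximal function of an integrable function. -/
def vortMaxFun (ω : R2 → ℝ) (r : ℝ) : ℝ :=
  ⨆ x : R2, ∫ y in closedBall x r, |ω y|


lemma aux_log_bound (r : ℝ) (hr : 0 < r) : r * |Real.log r| ≤ 1 + r ^ 2 := by
  have h1 := Real.log_le_sub_one_of_pos hr
  have h2 := Real.log_le_sub_one_of_pos (inv_pos.2 hr)
  rw [Real.log_inv] at h2
  have h3 : r * r⁻¹ = 1 := mul_inv_cancel₀ hr.ne'
  rcases abs_cases (Real.log r) with ⟨h, _⟩ | ⟨h, _⟩ <;> rw [h]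
  · nlinarith
  · have := mul_le_mul_of_nonneg_left h2 hr.le
    nlinarith

lemma aux_kernel_bound {E : Type*} [NormedAddCommGroup E] (ε : ℝ) (hε : 0 < ε) (a : E) :
    ∃ K : ℝ, 0 < K ∧ ∀ x : E,
      ((ε ^ 2 + ‖x - a‖ ^ 2) ^ 2)⁻¹ ≤ K * ((1 + ‖x‖) ^ 4)⁻¹ := by
  refine ⟨((1 + ‖a‖) ^ 2 * (2 * (1 + (ε ^ 2)⁻¹))) ^ 2, by positivity, fun x => ?_⟩
  set t := ‖x - a‖
  have ht : 0 ≤ t := norm_nonneg _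
  have h1 : 1 + ‖x‖ ≤ (1 + ‖a‖) * (1 + t) := by
    have : ‖x‖ ≤ t + ‖a‖ := by
      have := norm_add_le (x - a) a
      simpa using this
    nlinarith [norm_nonneg a]
  have h2 : (1 + t) ^ 2 ≤ (2 * (1 + (ε ^ 2)⁻¹)) * (ε ^ 2 + t ^ 2) := by
    have h3 : (ε ^ 2)⁻¹ * ε ^ 2 = 1 := inv_mul_cancel₀ (by positivity)
    have h4 : 0 ≤ (ε ^ 2)⁻¹ * t ^ 2 := by positivity
    nlinarith [sq_nonneg (1 - t), sq_nonneg ε]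
  have h5 : (1 + ‖x‖) ^ 2 ≤ ((1 + ‖a‖) ^ 2 * (2 * (1 + (ε ^ 2)⁻¹))) * (ε ^ 2 + t ^ 2) := by
    calc (1 + ‖x‖) ^ 2 ≤ ((1 + ‖a‖) * (1 + t)) ^ 2 := by gcongr
      _ = (1 + ‖a‖) ^ 2 * (1 + t) ^ 2 := by ring
      _ ≤ (1 + ‖a‖) ^ 2 * ((2 * (1 + (ε ^ 2)⁻¹)) * (ε ^ 2 + t ^ 2)) := by gcongr
      _ = _ := by ring
  have h6 : (1 + ‖x‖) ^ 4 ≤ ((1 + ‖a‖) ^ 2 * (2 * (1 + (ε ^ 2)⁻¹))) ^ 2 * (ε ^ 2 + t ^ 2) ^ 2 := by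
    calc (1 + ‖x‖) ^ 4 = ((1 + ‖x‖) ^ 2) ^ 2 := by ring
      _ ≤ (((1 + ‖a‖) ^ 2 * (2 * (1 + (ε ^ 2)⁻¹))) * (ε ^ 2 + t ^ 2)) ^ 2 := by gcongr
      _ = _ := by ring
  rw [← div_eq_mul_inv, le_div_iff₀ (by positivity), inv_mul_le_iff₀ (by positivity)]
  linarith

section
variable {E : Type*} [NormedAddCommGroup E] [NormedSpace ℝ E] [FiniteDimensional ℝ E]
  [MeasurableSpace E] [BorelSpace E] (μ : Measure E) [μ.IsAddHaarMeasure]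

lemma aux_int1 (hE : Module.finrank ℝ E = 2) :
    Integrable (fun x : E => |Real.log ‖x‖| * ((1 + ‖x‖) ^ 4)⁻¹) μ := by
  have : Nontrivial E := Module.nontrivial_of_finrank_pos (R := ℝ) (by omega)
  rw [integrable_fun_norm_addHaar μ (f := fun r => |Real.log r| * ((1 + r) ^ 4)⁻¹), hE]
  have h := (integrable_one_add_norm (E := ℝ) (μ := volume) (r := 2) (by simp)).integrableOn
    (s := Set.Ioi (0:ℝ))
  refine Integrable.mono' h (by fun_prop) ?_
  filter_upwards [ae_restrict_mem measurableSet_Ioi] with r hr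
  have hr : 0 < r := hr
  have h1 := aux_log_bound r hr
  simp only [Nat.add_one_sub_one, pow_one, smul_eq_mul, norm_mul, Real.norm_eq_abs, abs_abs, norm_inv]
  rw [abs_of_pos hr, abs_of_pos (show 0 < (1 + r)^4 by positivity), Real.rpow_neg (by positivity)]
  norm_cast
  rw [← mul_assoc, ← div_eq_mul_inv, div_le_iff₀ (by positivity), ← div_eq_inv_mul,
    le_div_iff₀ (by positivity)]
  have : 1 + r ^ 2 ≤ (1 + r) ^ 2 := by nlinarith
  calc _ ≤ (1 + r) ^ 2 * (1 + r) ^ 2 := by gcongr; linarith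
    _ = _ := by ring

lemma aux_int2 (hE : Module.finrank ℝ E = 2) :
    Integrable (fun x : E => (1 + ‖x‖) * ((1 + ‖x‖) ^ 4)⁻¹) μ := by
  have h := (integrable_one_add_norm (E := E) (μ := μ) (r := 3) (by rw [hE]; norm_num))
  refine h.congr (Filter.Eventually.of_forall fun x => ?_)
  have : 0 < 1 + ‖x‖ := by positivity
  simp only
  rw [Real.rpow_neg (by positivity)]
  norm_cast
  field_simp

/-- integrability of log against the kernel -/
lemma aux_intlog (hE : Module.finrank ℝ E = 2) (ε : ℝ) (hε : 0 < ε) (p q : E) :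
    Integrable (fun x : E => Real.log ‖x - p‖ * ((ε ^ 2 + ‖x - q‖ ^ 2) ^ 2)⁻¹) μ := by
  have : Integrable (fun x : E => Real.log ‖x‖ * ((ε ^ 2 + ‖x - (q - p)‖ ^ 2) ^ 2)⁻¹) μ := by
    obtain ⟨K, hK, h⟩ := aux_kernel_bound ε hε (q - p)
    refine Integrable.mono' ((aux_int1 μ hE).const_mul K) (by fun_prop) ?_
    refine Filter.Eventually.of_forall fun x => ?_
    rw [norm_mul, Real.norm_eq_abs, Real.norm_of_nonneg (by positivity)]
    calc _ ≤ |Real.log ‖x‖| * (K * ((1 + ‖x‖) ^ 4)⁻¹) := by gcongr; exact h x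
      _ = _ := by ring
  have h2 := this.comp_sub_right p
  refine h2.congr (Filter.Eventually.of_forall fun x => ?_)
  simp only
  rw [sub_sub_sub_cancel_right]

lemma aux_intG (hE : Module.finrank ℝ E = 2) (ε : ℝ) (hε : 0 < ε) (hε1 : ε ≤ 1) (p q : E) :
    Integrable (fun x : E => Real.log (‖x - p‖ ^ 2 + ε ^ 2) * ((ε ^ 2 + ‖x - q‖ ^ 2) ^ 2)⁻¹) μ := by
  have : Integrable (fun x : E => Real.log (‖x‖ ^ 2 + ε ^ 2) *
      ((ε ^ 2 + ‖x - (q - p)‖ ^ 2) ^ 2)⁻¹) μ := by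
    obtain ⟨K, hK, h⟩ := aux_kernel_bound ε hε (q - p)
    refine Integrable.mono' ((aux_int2 μ hE).const_mul ((2 + 2 * |Real.log ε|) * K)) (by fun_prop) ?_
    refine Filter.Eventually.of_forall fun x => ?_
    rw [norm_mul, Real.norm_eq_abs, Real.norm_of_nonneg (by positivity)]
    have h1 : |Real.log (‖x‖ ^ 2 + ε ^ 2)| ≤ (2 + 2 * |Real.log ε|) * (1 + ‖x‖) := by
      have hx := norm_nonneg x
      have a1 : Real.log (‖x‖ ^ 2 + ε ^ 2) ≤ 2 * ‖x‖ := by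
        calc _ ≤ Real.log ((1 + ‖x‖) ^ 2) := by
              apply Real.log_le_log (by positivity); nlinarith
          _ = 2 * Real.log (1 + ‖x‖) := by rw [Real.log_pow]; norm_num
          _ ≤ _ := by
              have := Real.log_le_sub_one_of_pos (show 0 < 1 + ‖x‖ by positivity)
              linarith
      have a2 : 2 * Real.log ε ≤ Real.log (‖x‖ ^ 2 + ε ^ 2) := by
        calc 2 * Real.log ε = Real.log (ε ^ 2) := by rw [Real.log_pow]; norm_num
          _ ≤ _ := by apply Real.log_le_log (by positivity); nlinarith
      have a3 := neg_abs_le (Real.log ε)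
      have a4 : 0 ≤ |Real.log ε| * ‖x‖ := by positivity
      rw [abs_le]
      constructor <;> nlinarith [abs_nonneg (Real.log ε)]
    calc _ ≤ ((2 + 2 * |Real.log ε|) * (1 + ‖x‖)) * (K * ((1 + ‖x‖) ^ 4)⁻¹) := by
            gcongr; exact h x
      _ = _ := by ring
  have h2 := this.comp_sub_right p
  refine h2.congr (Filter.Eventually.of_forall fun x => ?_)
  simp only
  rw [sub_sub_sub_cancel_right]

lemma aux_intK (hE : Module.finrank ℝ E = 2) (ε : ℝ) (hε : 0 < ε) (q : E) :
    Integrable (fun x : E => ((ε ^ 2 + ‖x - q‖ ^ 2) ^ 2)⁻¹) μ := by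
  obtain ⟨K, hK, h⟩ := aux_kernel_bound ε hε q
  refine Integrable.mono' ((aux_int2 μ hE).const_mul K) (by fun_prop) ?_
  refine Filter.Eventually.of_forall fun x => ?_
  rw [Real.norm_of_nonneg (by positivity)]
  refine (h x).trans ?_
  gcongr
  exact le_mul_of_one_le_left (by positivity) (by simp)

end

open Filter Topology in
lemma aux_tend (ε : ℝ) (hε : 0 < ε) :
    Tendsto (fun r : ℝ => 2 * Real.log r - Real.log (r ^ 2 + ε ^ 2)) atTop (𝓝 0) := by
  have h1 : Tendsto (fun r : ℝ => 1 + ε ^ 2 / r ^ 2) atTop (𝓝 (1 + 0)) :=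
    tendsto_const_nhds.add (tendsto_const_nhds.div_atTop (tendsto_pow_atTop (by norm_num)))
  rw [add_zero] at h1
  have h2 := ((Real.continuousAt_log one_ne_zero).tendsto.comp h1).neg
  rw [Real.log_one, neg_zero] at h2
  refine h2.congr' ?_
  filter_upwards [eventually_gt_atTop 0] with r hr
  simp only [Function.comp]
  rw [show 1 + ε ^ 2 / r ^ 2 = (r ^ 2 + ε ^ 2) / r ^ 2 by field_simp,
    Real.log_div (by positivity) (by positivity), Real.log_pow]
  push_cast; ring

lemma aux_deriv (ε : ℝ) (hε : 0 < ε) (r : ℝ) (hr : 0 < r) :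
    HasDerivAt (fun r : ℝ => 2 * Real.log r - Real.log (r ^ 2 + ε ^ 2))
      (2 * ε ^ 2 / (r * (r ^ 2 + ε ^ 2))) r := by
  have h1 := (Real.hasDerivAt_log hr.ne').const_mul 2
  have h2 := (((hasDerivAt_id r).pow 2).add_const (ε ^ 2)).log (by simp; positivity)
  refine (h1.sub h2).congr_deriv ?_
  simp
  field_simp
  ring

/-- radial layer-cake representation -/
lemma aux_layer (ε : ℝ) (hε : 0 < ε) (r : ℝ) (hr : 0 < r) :
    ENNReal.ofReal (Real.log (r ^ 2 + ε ^ 2) - 2 * Real.log r) =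
      ∫⁻ s in Set.Ioi r, ENNReal.ofReal (2 * ε ^ 2 / (s * (s ^ 2 + ε ^ 2))) := by
  have hd : ∀ x ∈ Set.Ici r, HasDerivAt (fun r : ℝ => 2 * Real.log r - Real.log (r ^ 2 + ε ^ 2))
      (2 * ε ^ 2 / (x * (x ^ 2 + ε ^ 2))) x := fun x hx => aux_deriv ε hε x (hr.trans_le hx)
  have hp : ∀ x ∈ Set.Ioi r, 0 ≤ 2 * ε ^ 2 / (x * (x ^ 2 + ε ^ 2)) := fun x hx => by
    have : 0 < x := hr.trans hx
    positivity
  have hi := integrableOn_Ioi_deriv_of_nonneg' hd hp (aux_tend ε hε)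
  have h := integral_Ioi_of_hasDerivAt_of_nonneg' hd hp (aux_tend ε hε)
  rw [← ofReal_integral_eq_lintegral_ofReal hi, h]
  · congr 1; ring
  · filter_upwards [ae_restrict_mem measurableSet_Ioi] with x hx using hp x hx

lemma aux_radial (α ε : ℝ) (hα0 : 0 < α) (hα2 : α < 2) (hε : 0 < ε) :
    ∫⁻ s in Set.Ioi 0, ENNReal.ofReal (2 * ε ^ 2 / (s * (s ^ 2 + ε ^ 2)) * s ^ α) ≤
      ENNReal.ofReal (2 * (1 / α + 1 / (2 - α)) * ε ^ α) := by
  rw [← Set.Ioc_union_Ioi_eq_Ioi hε.le, lintegral_union measurableSet_Ioi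
    (Set.disjoint_left.2 fun x hx hx' => not_lt.2 hx.2 hx')]
  have h1 : ∫⁻ s in Set.Ioc 0 ε, ENNReal.ofReal (2 * ε ^ 2 / (s * (s ^ 2 + ε ^ 2)) * s ^ α) ≤
      ENNReal.ofReal (2 * (ε ^ α / α)) := by
    have hi : IntegrableOn (fun s : ℝ => 2 * s ^ (α - 1)) (Set.Ioc 0 ε) := by
      have := (intervalIntegral.intervalIntegrable_rpow' (a := 0) (b := ε)
        (r := α - 1) (by linarith)).1
      exact this.const_mul 2
    have hv : ∫ s in Set.Ioc 0 ε, 2 * s ^ (α - 1) = 2 * (ε ^ α / α) := by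
      rw [← intervalIntegral.integral_of_le hε.le, intervalIntegral.integral_const_mul,
        integral_rpow (Or.inl (by linarith))]
      simp [Real.zero_rpow hα0.ne']
    rw [← hv, ofReal_integral_eq_lintegral_ofReal hi]
    · refine setLIntegral_mono (by fun_prop) fun s hs => ENNReal.ofReal_le_ofReal ?_
      have hs0 : 0 < s := hs.1
      rw [Real.rpow_sub_one hs0.ne', div_mul_eq_mul_div, div_le_iff₀ (by positivity)]
      have : 0 < s ^ α := by positivity
      field_simp
      nlinarith [sq_nonneg s]
    · filter_upwards [ae_restrict_mem measurableSet_Ioc] with x hx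
      have := hx.1
      simp only [Pi.zero_apply]; positivity
  have h2 : ∫⁻ s in Set.Ioi ε, ENNReal.ofReal (2 * ε ^ 2 / (s * (s ^ 2 + ε ^ 2)) * s ^ α) ≤
      ENNReal.ofReal (2 * (ε ^ α / (2 - α))) := by
    have hi : IntegrableOn (fun s : ℝ => 2 * ε ^ 2 * s ^ (α - 3)) (Set.Ioi ε) :=
      (integrableOn_Ioi_rpow_of_lt (by linarith) hε).const_mul _
    have hv : ∫ s in Set.Ioi ε, 2 * ε ^ 2 * s ^ (α - 3) = 2 * (ε ^ α / (2 - α)) := by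
      rw [integral_const_mul, integral_Ioi_rpow_of_lt (by linarith) hε,
        show α - 3 + 1 = α - (2:ℕ) by push_cast; ring, Real.rpow_sub_natCast hε.ne']
      have : α - 2 ≠ 0 := by linarith
      have : 2 - α ≠ 0 := by linarith
      push_cast
      rw [show 2 - α = -(α - 2) by ring]
      field_simp
    rw [← hv, ofReal_integral_eq_lintegral_ofReal hi]
    · refine setLIntegral_mono (by fun_prop) fun s hs => ENNReal.ofReal_le_ofReal ?_
      have hs0 : 0 < s := hε.trans hs
      rw [show α - 3 = α - (3:ℕ) by push_cast; ring, Real.rpow_sub_natCast hs0.ne',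
        div_mul_eq_mul_div, div_le_iff₀ (by positivity)]
      have : 0 < s ^ α := by positivity
      field_simp
      nlinarith [sq_nonneg s]
    · filter_upwards [ae_restrict_mem measurableSet_Ioi] with x hx
      have : 0 < x := hε.trans hx
      simp only [Pi.zero_apply]; positivity
  refine (add_le_add h1 h2).trans_eq ?_
  have : 0 < 2 - α := by linarith
  rw [← ENNReal.ofReal_add (by positivity) (by positivity)]
  congr 1; field_simp

/-- the main maximal-function estimate -/
lemma aux_max (α ε C_M : ℝ) (hα0 : 0 < α) (hα2 : α < 2) (hε : 0 < ε) (hCM : 0 < C_M)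
    (ω : EuclideanSpace ℝ (Fin 2) → ℝ) (hc : Continuous ω) (hω : Integrable ω)
    (hM : ∀ r : ℝ, 0 < r → vortMaxFun ω r ≤ C_M * r ^ α) (z : EuclideanSpace ℝ (Fin 2)) :
    |∫ x, (Real.log (‖x - z‖ ^ 2 + ε ^ 2) - 2 * Real.log ‖x - z‖) * ω x| ≤
      C_M * (2 * (1 / α + 1 / (2 - α)) * ε ^ α) := by
  have h2α : 0 < 2 - α := by linarith
  have hball : ∀ s : ℝ, 0 < s →
      ∫⁻ x in closedBall z s, ENNReal.ofReal |ω x| ≤ ENNReal.ofReal (C_M * s ^ α) := by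
    intro s hs
    rw [← ofReal_integral_eq_lintegral_ofReal hω.abs.integrableOn
      (Filter.Eventually.of_forall fun x => abs_nonneg _)]
    refine ENNReal.ofReal_le_ofReal (le_trans ?_ (hM s hs))
    refine le_ciSup (f := fun x => ∫ y in closedBall x s, |ω y|) ⟨∫ y, |ω y|, ?_⟩ z
    rintro _ ⟨x, rfl⟩
    exact setIntegral_le_integral hω.abs (Filter.Eventually.of_forall fun x => abs_nonneg _)
  set k : ℝ → ENNReal := fun s => ENNReal.ofReal (2 * ε ^ 2 / (s * (s ^ 2 + ε ^ 2))) with hk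
  have hkm : Measurable k := by fun_prop
  have key : ∫⁻ x, ENNReal.ofReal
      |(Real.log (‖x - z‖ ^ 2 + ε ^ 2) - 2 * Real.log ‖x - z‖) * ω x| ≤
      ENNReal.ofReal (C_M * (2 * (1 / α + 1 / (2 - α)) * ε ^ α)) := by
    calc _ = ∫⁻ x, ∫⁻ s in Set.Ioi 0,
          (if ‖x - z‖ < s then k s * ENNReal.ofReal |ω x| else 0) := by
          apply lintegral_congr_ae
          filter_upwards [compl_mem_ae_iff.2 (measure_singleton z)] with x hx
          have hr : 0 < ‖x - z‖ := norm_pos_iff.2 (sub_ne_zero.2 hx)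
          rw [abs_mul, ENNReal.ofReal_mul (abs_nonneg _), abs_of_nonneg, aux_layer ε hε _ hr,
            ← lintegral_mul_const _ hkm, ← lintegral_indicator measurableSet_Ioi,
            ← lintegral_indicator measurableSet_Ioi]
          · congr 1; ext s
            simp only [Set.indicator, Set.mem_Ioi]
            by_cases h : ‖x - z‖ < s
            · simp [h, hr.trans h, hk]
            · simp [h]
          · have : Real.log (‖x - z‖ ^ 2) ≤ Real.log (‖x - z‖ ^ 2 + ε ^ 2) :=
              Real.log_le_log (by positivity) (by nlinarith)
            rw [Real.log_pow] at this
            push_cast at this; linarith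
      _ = ∫⁻ s in Set.Ioi 0, ∫⁻ x,
          (if ‖x - z‖ < s then k s * ENNReal.ofReal |ω x| else 0) := by
          rw [lintegral_lintegral_swap]
          apply Measurable.aemeasurable
          apply Measurable.ite
          · exact measurableSet_lt (by fun_prop) (by fun_prop)
          · have := hc.measurable
            fun_prop
          · fun_prop
      _ ≤ ∫⁻ s in Set.Ioi 0, ENNReal.ofReal C_M *
            ENNReal.ofReal (2 * ε ^ 2 / (s * (s ^ 2 + ε ^ 2)) * s ^ α) := by
          refine setLIntegral_mono (by fun_prop) fun s hs => ?_
          have hs : 0 < s := hs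
          calc _ ≤ ∫⁻ x, k s * (closedBall z s).indicator (fun x => ENNReal.ofReal |ω x|) x := by
                apply lintegral_mono
                intro x
                by_cases h : ‖x - z‖ < s
                · have : x ∈ closedBall z s := by
                    rw [mem_closedBall, dist_eq_norm]; exact h.le
                  simp [h, this]
                · simp [h]
            _ = k s * ∫⁻ x in closedBall z s, ENNReal.ofReal |ω x| := by
                rw [lintegral_const_mul' _ _ (by simp [hk]),
                  lintegral_indicator measurableSet_closedBall]
            _ ≤ k s * ENNReal.ofReal (C_M * s ^ α) := by gcongr; exact hball s hs
            _ = _ := by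
                rw [hk, ← ENNReal.ofReal_mul (by positivity), ← ENNReal.ofReal_mul (by positivity)]
                congr 1; ring
      _ = ENNReal.ofReal C_M * ∫⁻ s in Set.Ioi 0, 
            ENNReal.ofReal (2 * ε ^ 2 / (s * (s ^ 2 + ε ^ 2)) * s ^ α) :=
          lintegral_const_mul' _ _ (by simp)
      _ ≤ ENNReal.ofReal C_M * ENNReal.ofReal (2 * (1 / α + 1 / (2 - α)) * ε ^ α) := by
          gcongr; exact aux_radial α ε hα0 hα2 hε
      _ = _ := (ENNReal.ofReal_mul hCM.le).symm
  have h3 := norm_integral_le_lintegral_norm (μ := volume) 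
    (fun x => (Real.log (‖x - z‖ ^ 2 + ε ^ 2) - 2 * Real.log ‖x - z‖) * ω x)
  rw [Real.norm_eq_abs] at h3
  refine h3.trans (ENNReal.toReal_le_of_le_ofReal (by positivity) ?_)
  simpa only [Real.norm_eq_abs] using key

open Filter Topology in
lemma aux_tend2 (ε : ℝ) (hε : 0 < ε) :
    Tendsto (fun r : ℝ => r ^ 2 * Real.log r / (ε ^ 2 + r ^ 2) / 2
      - Real.log (r ^ 2 + ε ^ 2) / 4) atTop (𝓝 0) := by
  have h1 : Tendsto (fun r : ℝ => Real.log r / (ε ^ 2 + r ^ 2)) atTop (𝓝 0) := by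
    refine squeeze_zero' ?_ ?_ tendsto_inv_atTop_zero
    · filter_upwards [eventually_ge_atTop 1] with r hr
      have := Real.log_nonneg hr
      positivity
    · filter_upwards [eventually_ge_atTop 1] with r hr
      have h0 : 0 < r := by linarith
      rw [div_le_iff₀ (by positivity)]
      have := Real.log_le_sub_one_of_pos h0
      field_simp
      nlinarith [sq_nonneg ε]
  have h2 := ((aux_tend ε hε).div_const 4).sub (h1.const_mul (ε ^ 2 / 2))
  simp only [zero_div, mul_zero, sub_zero] at h2
  refine h2.congr fun r => ?_
  have : ε ^ 2 + r ^ 2 ≠ 0 := by positivity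
  field_simp
  ring

lemma aux_deriv2 (ε : ℝ) (hε : 0 < ε) (r : ℝ) (hr : 0 < r) :
    HasDerivAt (fun r : ℝ => r ^ 2 * Real.log r / (ε ^ 2 + r ^ 2) / 2
      - Real.log (r ^ 2 + ε ^ 2) / 4) (r * (Real.log r * (ε ^ 2 * ((ε ^ 2 + r ^ 2) ^ 2)⁻¹))) r := by
  have h0 := hasDerivAt_pow 2 r
  have h1 := ((h0.mul (Real.hasDerivAt_log hr.ne')).div (h0.const_add (ε ^ 2))
    (by positivity)).div_const 2
  have h2 := ((h0.add_const (ε ^ 2)).log (by positivity)).div_const 4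
  refine (h1.sub h2).congr_deriv ?_
  simp
  field_simp
  ring

lemma aux_cont2 (ε : ℝ) (hε : 0 < ε) :
    Continuous (fun r : ℝ => r ^ 2 * Real.log r / (ε ^ 2 + r ^ 2) / 2
      - Real.log (r ^ 2 + ε ^ 2) / 4) := by
  have h1 : Continuous (fun r : ℝ => r * (r * Real.log r)) :=
    continuous_id.mul Real.continuous_mul_log
  have h2 : Continuous (fun r : ℝ => r ^ 2 * Real.log r) := by
    refine h1.congr fun r => by ring
  refine Continuous.sub ((h2.div (by fun_prop) fun r => by positivity).div_const _) ?_
  refine (Continuous.log (by fun_prop) fun r => by positivity).div_const _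

lemma aux_intrad (ε : ℝ) (hε : 0 < ε) :
    IntegrableOn (fun r : ℝ => r * (Real.log r * (ε ^ 2 * ((ε ^ 2 + r ^ 2) ^ 2)⁻¹)))
      (Set.Ioi 0) := by
  have h := ((aux_intlog (volume : Measure ℂ) Complex.finrank_real_complex ε hε 0 0).const_mul
    (ε ^ 2))
  simp only [sub_zero] at h
  rw [integrable_fun_norm_addHaar volume
    (f := fun r => ε ^ 2 * (Real.log r * ((ε ^ 2 + r ^ 2) ^ 2)⁻¹)),
    Complex.finrank_real_complex] at h
  refine h.congr (Filter.Eventually.of_forall fun r => ?_)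
  simp only [Nat.add_one_sub_one, pow_one, smul_eq_mul]; ring

lemma aux_radint (ε : ℝ) (hε : 0 < ε) (b : ℝ) (hb : 0 ≤ b) :
    ∫ r in Set.Ioi (0:ℝ), r * ((Real.log r + Real.posLog (r⁻¹ * b)) *
      (ε ^ 2 * ((ε ^ 2 + r ^ 2) ^ 2)⁻¹)) = Real.log (b ^ 2 + ε ^ 2) / 4 := by
  have e1 : Set.EqOn (fun r => r * ((Real.log r + Real.posLog (r⁻¹ * b)) *
      (ε ^ 2 * ((ε ^ 2 + r ^ 2) ^ 2)⁻¹)))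
      (fun r => Real.log b * (r * (ε ^ 2 * ((ε ^ 2 + r ^ 2) ^ 2)⁻¹))) (Set.Ioc 0 b) := by
    intro r hr
    have h0 : 0 < r := hr.1
    have hb0 : 0 < b := h0.trans_le hr.2
    simp only
    rw [Real.posLog_eq_log, Real.log_mul (by positivity) (by positivity), Real.log_inv]
    · ring
    · rw [abs_of_nonneg (by positivity), ← div_eq_inv_mul, le_div_iff₀ h0]; linarith [hr.2]
  have e2 : Set.EqOn (fun r => r * ((Real.log r + Real.posLog (r⁻¹ * b)) *
      (ε ^ 2 * ((ε ^ 2 + r ^ 2) ^ 2)⁻¹)))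
      (fun r => r * (Real.log r * (ε ^ 2 * ((ε ^ 2 + r ^ 2) ^ 2)⁻¹))) (Set.Ioi b) := by
    intro r hr
    have h0 : 0 < r := hb.trans_lt hr
    simp only
    rw [(Real.posLog_eq_zero_iff _).2, add_zero]
    rw [abs_of_nonneg (by positivity), ← div_eq_inv_mul, div_le_iff₀ h0]; 
    have : b < r := hr
    linarith
  have c1 : Continuous (fun r : ℝ => (r * (ε ^ 2 * ((ε ^ 2 + r ^ 2) ^ 2)⁻¹))) := by
    refine continuous_id.mul (continuous_const.mul (Continuous.inv₀ (by fun_prop) fun r => ?_))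
    positivity
  have i1 : IntegrableOn (fun r => Real.log b * (r * (ε ^ 2 * ((ε ^ 2 + r ^ 2) ^ 2)⁻¹)))
      (Set.Ioc 0 b) := ((c1.integrableOn_Icc).mono_set Set.Ioc_subset_Icc_self).const_mul _
  have i2 := (aux_intrad ε hε).mono_set (Set.Ioi_subset_Ioi hb)
  have hdisj : Disjoint (Set.Ioc 0 b) (Set.Ioi b) :=
    Set.disjoint_left.2 fun x hx hx' => not_lt.2 hx.2 hx'
  rw [← Set.Ioc_union_Ioi_eq_Ioi hb, setIntegral_union hdisj measurableSet_Ioi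
    (i1.congr_fun e1.symm measurableSet_Ioc) (i2.congr_fun e2.symm measurableSet_Ioi),
    setIntegral_congr_fun measurableSet_Ioc e1, setIntegral_congr_fun measurableSet_Ioi e2,
    integral_Ioi_of_hasDerivAt_of_tendsto (aux_cont2 ε hε).continuousWithinAt
      (fun x hx => aux_deriv2 ε hε x (hb.trans_lt hx)) i2 (aux_tend2 ε hε),
    integral_const_mul, ← intervalIntegral.integral_of_le hb,
    intervalIntegral.integral_eq_sub_of_hasDerivAt
      (f := fun r => - (ε ^ 2 * (ε ^ 2 + r ^ 2)⁻¹) / 2) _ (c1.intervalIntegrable _ _)]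
  · have : ε ^ 2 + b ^ 2 ≠ 0 := by positivity
    field_simp
    ring
  · intro x _
    have h := ((((hasDerivAt_pow 2 x).const_add (ε ^ 2)).inv (by positivity)).const_mul
      (ε ^ 2)).neg.div_const 2
    refine h.congr_deriv ?_
    field_simp
    simp [mul_comm]

lemma aux_circ (r : ℝ) (hr : 0 < r) (a : ℂ) :
    ∫ θ in Set.Ioo (-Real.pi) Real.pi, Real.log ‖circleMap 0 r θ - a‖ =
      2 * Real.pi * (Real.log r + Real.posLog (r⁻¹ * ‖a‖)) := by
  have h := circleAverage_log_norm_sub_const_eq_log_radius_add_posLog (a := a) (c := 0) hr.ne'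
  rw [Real.circleAverage_def] at h
  simp only [zero_sub, norm_neg, smul_eq_mul] at h
  rw [← h, ← integral_Ioc_eq_integral_Ioo,
    ← intervalIntegral.integral_of_le (by linarith [Real.pi_pos])]
  have hp : Function.Periodic (fun θ => Real.log ‖circleMap 0 r θ - a‖) (2 * Real.pi) := by
    intro θ
    simp only [periodic_circleMap 0 r θ]
  have h2 := hp.intervalIntegral_add_eq (-Real.pi) 0
  rw [zero_add, show -Real.pi + 2 * Real.pi = Real.pi by ring] at h2
  rw [h2]
  field_simp

lemma aux_complex (ε : ℝ) (hε : 0 < ε) (a : ℂ) :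
    ∫ x : ℂ, Real.log ‖x - a‖ * (ε ^ 2 * ((ε ^ 2 + ‖x‖ ^ 2) ^ 2)⁻¹) =
      Real.pi * (Real.log (‖a‖ ^ 2 + ε ^ 2) / 2) := by
  set f : ℂ → ℝ := fun x => Real.log ‖x - a‖ * (ε ^ 2 * ((ε ^ 2 + ‖x‖ ^ 2) ^ 2)⁻¹) with hf
  have hfm : Measurable f := by fun_prop
  have hfi : Integrable f := by
    have h := ((aux_intlog (volume : Measure ℂ) Complex.finrank_real_complex ε hε a 0).const_mul
      (ε ^ 2))
    simp only [sub_zero] at h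
    refine h.congr (Filter.Eventually.of_forall fun r => ?_)
    simp only [hf]; ring
  have hsymm : ∀ p : ℝ × ℝ, Complex.polarCoord.symm p = circleMap 0 p.1 p.2 := by
    intro p
    rw [Complex.polarCoord_symm_apply, circleMap, zero_add, Complex.exp_mul_I]
    simp
  have hm : Measurable fun p : ℝ × ℝ => f (circleMap 0 p.1 p.2) := by
    refine hfm.comp ?_
    unfold circleMap
    fun_prop
  have hint : IntegrableOn (fun p : ℝ × ℝ => p.1 • f (circleMap 0 p.1 p.2))
      (Set.Ioi (0:ℝ) ×ˢ Set.Ioo (-Real.pi) Real.pi) := by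
    refine ⟨(measurable_fst.smul hm).aestronglyMeasurable, ?_⟩
    have h := Complex.lintegral_comp_polarCoord_symm (fun x => ‖f x‖ₑ)
    have h2 := hfi.2
    rw [HasFiniteIntegral, ← h, polarCoord_target] at h2
    rw [HasFiniteIntegral]
    refine lt_of_le_of_lt (le_of_eq ?_) h2
    refine setLIntegral_congr_fun (measurableSet_Ioi.prod measurableSet_Ioo) fun p hp => ?_
    have hp1 : 0 < p.1 := hp.1
    simp only [hsymm, smul_eq_mul]
    rw [enorm_mul, Real.enorm_of_nonneg hp1.le]
  rw [← Complex.integral_comp_polarCoord_symm, polarCoord_target]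
  simp only [hsymm]
  rw [Measure.volume_eq_prod] at hint ⊢
  rw [setIntegral_prod _ hint]
  have : ∀ r ∈ Set.Ioi (0:ℝ), (∫ θ in Set.Ioo (-Real.pi) Real.pi, r • f (circleMap 0 r θ)) =
      2 * Real.pi * (r * ((Real.log r + Real.posLog (r⁻¹ * ‖a‖)) *
      (ε ^ 2 * ((ε ^ 2 + r ^ 2) ^ 2)⁻¹))) := by
    intro r hr
    have hr : 0 < r := hr
    simp only [hf, norm_circleMap_zero, sq_abs, smul_eq_mul]
    rw [integral_const_mul, integral_mul_const, aux_circ r hr]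
    ring
  rw [setIntegral_congr_fun measurableSet_Ioi this, integral_const_mul,
    aux_radint ε hε _ (norm_nonneg a)]
  ring

lemma aux_plane (ε : ℝ) (hε : 0 < ε) (p q : EuclideanSpace ℝ (Fin 2)) :
    ∫ x, Real.log ‖x - p‖ * (ε ^ 2 * ((ε ^ 2 + ‖x - q‖ ^ 2) ^ 2)⁻¹) =
      Real.pi * (Real.log (‖q - p‖ ^ 2 + ε ^ 2) / 2) := by
  let e := Complex.orthonormalBasisOneI.repr
  have h1 := integral_sub_right_eq_self (μ := volume) (fun x : EuclideanSpace ℝ (Fin 2) =>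
    Real.log ‖x - (p - q)‖ * (ε ^ 2 * ((ε ^ 2 + ‖x‖ ^ 2) ^ 2)⁻¹)) q
  simp only [sub_sub_sub_cancel_right] at h1
  rw [h1, ← e.measurePreserving.integral_comp e.toHomeomorph.measurableEmbedding]
  have h2 := aux_complex ε hε (e.symm (p - q))
  rw [LinearIsometryEquiv.norm_map, norm_sub_rev] at h2
  rw [← h2]
  congr 1; ext x
  rw [LinearIsometryEquiv.norm_map, ← LinearIsometryEquiv.norm_map e (x - _), map_sub,
    LinearIsometryEquiv.apply_symm_apply]

lemma aux_blob (ε : ℝ) (hε : 0 < ε) (x : EuclideanSpace ℝ (Fin 2)) :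
    (ε ^ 2)⁻¹ * blob (ε⁻¹ • x) = 1 / Real.pi * (ε ^ 2 * ((ε ^ 2 + ‖x‖ ^ 2) ^ 2)⁻¹) := by
  unfold blob
  rw [norm_smul, norm_inv, Real.norm_of_nonneg hε.le]
  have := Real.pi_pos
  have : ε ^ 2 + ‖x‖ ^ 2 ≠ 0 := by positivity
  have : 1 + (ε⁻¹ * ‖x‖) ^ 2 ≠ 0 := by positivity
  field_simp

theorem stmt14 (α C_M Ωbar : ℝ) (hα0 : 0 < α) (hα2 : α < 2)
    (hCM : 0 < C_M) (hΩ : 0 < Ωbar) :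
    ∃ C : ℝ, 0 < C ∧
      ∀ (ε : ℝ), 0 < ε → ε ≤ 1 →
      ∀ (N : ℕ) (ξ : Fin N → ℝ) (X : Fin N → R2),
        (∑ j, |ξ j|) ≤ Ωbar →
        -- the mollified vorticity `ω^ε(x) = ∑ⱼ ξⱼ φ_ε(x − Xⱼ)`, `φ_ε(x) = ε⁻² φ(x/ε)`
        (∀ r : ℝ, 0 < r →
            vortMaxFun (fun x => ∑ j, ξ j * ((ε ^ 2)⁻¹ * blob (ε⁻¹ • (x - X j)))) r
              ≤ C_M * r ^ α) →
        -- `|E^ε − 𝓔^ε| ≤ C ε^α`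
        |(∫ x : R2, (∑ j, ξ j * Greg ε (x - X j)) *
              (∑ j, ξ j * ((ε ^ 2)⁻¹ * blob (ε⁻¹ • (x - X j)))))
            - ∑ i, ∑ j, ξ i * ξ j * Greg ε (X i - X j)| ≤ C * ε ^ α := by
  have h2α : 0 < 2 - α := by linarith
  have hπ := Real.pi_pos
  have hdim : Module.finrank ℝ (EuclideanSpace ℝ (Fin 2)) = 2 := by simp
  set B : ℝ := C_M * (2 * (1 / α + 1 / (2 - α))) with hB
  have hBpos : 0 < B := by positivity
  refine ⟨Ωbar * (1 / (4 * Real.pi) * B), by positivity, ?_⟩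
  intro ε hε hε1 N ξ X hξ hM
  set w : Fin N → R2 → ℝ := fun i x => (ε ^ 2)⁻¹ * blob (ε⁻¹ • (x - X i)) with hw
  have hwe : ∀ i x, w i x = 1 / Real.pi * (ε ^ 2 * ((ε ^ 2 + ‖x - X i‖ ^ 2) ^ 2)⁻¹) :=
    fun i x => aux_blob ε hε _
  set ω : R2 → ℝ := fun x => ∑ j, ξ j * w j x with hω
  have hwc : ∀ i, Continuous (w i) := by
    intro i
    rw [show w i = _ from funext (hwe i)]
    refine continuous_const.mul (continuous_const.mul (Continuous.inv₀ (by fun_prop) fun r => ?_))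
    positivity
  have hwi : ∀ i, Integrable (w i) := by
    intro i
    rw [show w i = _ from funext (hwe i)]
    exact ((aux_intK volume hdim ε hε (X i)).const_mul _).const_mul _
  have hωc : Continuous ω := by fun_prop
  have hωi : Integrable ω := integrable_finsetSum _ fun i _ => (hwi i).const_mul _
  -- integrability of the two kernels
  have hL : ∀ i j, Integrable (fun x => Real.log ‖x - X j‖ * w i x) := by
    intro i j
    refine ((aux_intlog volume hdim ε hε (X j) (X i)).const_mul
      (1 / Real.pi * ε ^ 2)).congr (Filter.Eventually.of_forall fun x => ?_)
    simp only [hwe]; ring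
  have hG : ∀ i j, Integrable (fun x => Real.log (‖x - X j‖ ^ 2 + ε ^ 2) * w i x) := by
    intro i j
    refine ((aux_intG volume hdim ε hε hε1 (X j) (X i)).const_mul
      (1 / Real.pi * ε ^ 2)).congr (Filter.Eventually.of_forall fun x => ?_)
    simp only [hwe]; ring
  have hLv : ∀ i j, ∫ x, Real.log ‖x - X j‖ * w i x = Real.log (‖X i - X j‖ ^ 2 + ε ^ 2) / 2 := by
    intro i j
    have h := aux_plane ε hε (X j) (X i)
    calc _ = ∫ x, 1 / Real.pi * (Real.log ‖x - X j‖ *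
          (ε ^ 2 * ((ε ^ 2 + ‖x - X i‖ ^ 2) ^ 2)⁻¹)) := by
          congr 1; ext x; rw [hwe]; ring
      _ = _ := by rw [integral_const_mul, h]; field_simp
  have hLω : ∀ j, Integrable (fun x => Real.log ‖x - X j‖ * ω x) := by
    intro j
    refine (integrable_finsetSum Finset.univ fun i _ => (hL i j).const_mul (ξ i)).congr
      (Filter.Eventually.of_forall fun x => ?_)
    simp only [hω, Finset.mul_sum]
    exact Finset.sum_congr rfl fun i _ => by ring
  have hGω : ∀ j, Integrable (fun x => Real.log (‖x - X j‖ ^ 2 + ε ^ 2) * ω x) := by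
    intro j
    refine (integrable_finsetSum Finset.univ fun i _ => (hG i j).const_mul (ξ i)).congr
      (Filter.Eventually.of_forall fun x => ?_)
    simp only [hω, Finset.mul_sum]
    exact Finset.sum_congr rfl fun i _ => by ring
  have hLωv : ∀ j, ∫ x, Real.log ‖x - X j‖ * ω x =
      ∑ i, ξ i * (Real.log (‖X i - X j‖ ^ 2 + ε ^ 2) / 2) := by
    intro j
    calc _ = ∫ x, ∑ i, ξ i * (Real.log ‖x - X j‖ * w i x) := by
          congr 1; ext x
          simp only [hω, Finset.mul_sum]
          exact Finset.sum_congr rfl fun i _ => by ring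
      _ = _ := by
          rw [integral_finsetSum _ fun i _ => (hL i j).const_mul (ξ i)]
          exact Finset.sum_congr rfl fun i _ => by rw [integral_const_mul, hLv]
  have hE : (∫ x : R2, (∑ j, ξ j * Greg ε (x - X j)) * ω x) =
      ∑ j, ξ j * (-(1 / (4 * Real.pi)) * ∫ x, Real.log (‖x - X j‖ ^ 2 + ε ^ 2) * ω x) := by
    calc _ = ∫ x, ∑ j, ξ j * (-(1 / (4 * Real.pi)) *
            (Real.log (‖x - X j‖ ^ 2 + ε ^ 2) * ω x)) := by
          congr 1; ext x
          rw [Finset.sum_mul]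
          exact Finset.sum_congr rfl fun i _ => by unfold Greg; ring
      _ = _ := by
          rw [integral_finsetSum _ fun i _ => ((hGω i).const_mul _).const_mul (ξ i)]
          exact Finset.sum_congr rfl fun i _ => by rw [integral_const_mul, integral_const_mul]
  have hH : ∑ i, ∑ j, ξ i * ξ j * Greg ε (X i - X j) =
      ∑ j, ξ j * (-(1 / (4 * Real.pi)) * (2 * ∫ x, Real.log ‖x - X j‖ * ω x)) := by
    rw [Finset.sum_comm]
    refine Finset.sum_congr rfl fun j _ => ?_
    rw [hLωv]
    simp only [Finset.mul_sum]
    refine Finset.sum_congr rfl fun i _ => ?_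
    unfold Greg
    ring
  have hD : ∀ j, |(∫ x, Real.log (‖x - X j‖ ^ 2 + ε ^ 2) * ω x) -
      2 * ∫ x, Real.log ‖x - X j‖ * ω x| ≤ B * ε ^ α := by
    intro j
    have h := aux_max α ε C_M hα0 hα2 hε hCM ω hωc hωi hM (X j)
    rw [← integral_const_mul, ← integral_sub (hGω j) ((hLω j).const_mul 2)]
    calc _ = _ := by
          congr 2; ext x
          ring
      _ ≤ _ := h
      _ = _ := by rw [hB]; ring
  rw [hE, hH, ← Finset.sum_sub_distrib]
  refine (Finset.abs_sum_le_sum_abs _ _).trans ?_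
  calc _ ≤ ∑ j, |ξ j| * (1 / (4 * Real.pi) * (B * ε ^ α)) := by
        refine Finset.sum_le_sum fun j _ => ?_
        rw [← mul_sub, ← mul_sub, abs_mul, abs_mul, abs_neg,
          abs_of_pos (show 0 < 1 / (4 * Real.pi) by positivity)]
        gcongr
        exact hD j
    _ = (∑ j, |ξ j|) * (1 / (4 * Real.pi) * (B * ε ^ α)) := by rw [Finset.sum_mul]
    _ ≤ Ωbar * (1 / (4 * Real.pi) * (B * ε ^ α)) := by gcongr
    _ = _ := by ring
end
end
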